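/- arXiv:0811.1046 — 11 statements merged into one kernel-verified Lean document; each statement's English description precedes it below -/
import Mathlib

section
/- Let U : ℝ → ℝ be positive and differentiable on an open interval, let ρ(s) = arcsinh(U(s)), and let λ be a differentiable function satisfying λ'(s)² = (1 + U(s)² − U'(s)²)/(1 + U(s)²)². If at a point s₀ the vertical tangency condition tanh(ρ(s₀))·λ'(s₀) + sech(ρ(s₀))²·ρ'(s₀) = 0 holds, then U(s₀)² = U'(s₀)². -/
/-- If `U` is positive and differentiable on an open interval, `ρ = arsinh ∘ U`, and `λ` is a
differentiable function with `λ'² = (1 + U² − U'²)/(1 + U²)²`, then at any vertical tangency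
point `s₀` (where `tanh(ρ)·λ' + sech²(ρ)·ρ' = 0`) one has `U(s₀)² = U'(s₀)²`. -/
theorem vertical_tangency_condition (α β : ℝ) (U lam ρ : ℝ → ℝ)
    (hUpos : ∀ s ∈ Set.Ioo α β, 0 < U s)
    (hUdiff : ∀ s ∈ Set.Ioo α β, DifferentiableAt ℝ U s)
    (hlamdiff : ∀ s ∈ Set.Ioo α β, DifferentiableAt ℝ lam s)
    (hρ : ∀ s, ρ s = Real.arsinh (U s))
    (hlam' : ∀ s ∈ Set.Ioo α β,
      (deriv lam s) ^ 2 = (1 + (U s) ^ 2 - (deriv U s) ^ 2) / (1 + (U s) ^ 2) ^ 2)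
    (s₀ : ℝ) (hs₀ : s₀ ∈ Set.Ioo α β)
    (htang : Real.tanh (ρ s₀) * deriv lam s₀
      + (1 / Real.cosh (ρ s₀)) ^ 2 * deriv ρ s₀ = 0) :
    (U s₀) ^ 2 = (deriv U s₀) ^ 2 := by
  have hw : 0 < 1 + U s₀ ^ 2 := by positivity
  have hsq : √(1 + U s₀ ^ 2) ^ 2 = 1 + U s₀ ^ 2 := Real.sq_sqrt hw.le
  have hderiv : deriv ρ s₀ = (√(1 + U s₀ ^ 2))⁻¹ * deriv U s₀ := by
    rw [funext hρ]
    exact (hUdiff s₀ hs₀).hasDerivAt.arsinh.deriv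
  have hlin : U s₀ * deriv lam s₀ * (1 + U s₀ ^ 2) = -deriv U s₀ := by
    rw [hρ, hderiv, Real.tanh_arsinh, Real.cosh_arsinh] at htang
    have hne : √(1 + U s₀ ^ 2) ≠ 0 := (Real.sqrt_pos.2 hw).ne'
    rw [← hsq]
    field_simp at htang
    linear_combination htang
  have hlam := hlam' s₀ hs₀
  rw [eq_div_iff (by positivity)] at hlam
  refine mul_right_cancel₀ hw.ne' ?_
  linear_combination
    (U s₀ * deriv lam s₀ * (1 + U s₀ ^ 2) - deriv U s₀) * hlin - U s₀ ^ 2 * hlam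
end

section
/- If −1/2 < a < −1/4, then there is no real number s satisfying (1+2a)⁴s⁴ + (2a²(1+2a)² − (1+2a)⁴)s² + a⁴ = 0. In particular the corresponding rotational surface of constant mean curvature H = 1 has no vertical tangency points. -/
/-- If `-1/2 < a < -1/4` then the vertical tangency equation
`(1+2a)⁴s⁴ + (2a²(1+2a)² − (1+2a)⁴)s² + a⁴ = 0` has no real solution: the corresponding
rotational surface of constant mean curvature `H = 1` has no vertical tangency points. -/
theorem no_vertical_tangency_H_eq_one (a : ℝ) (ha₁ : -1/2 < a) (ha₂ : a < -1/4) :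
    ¬ ∃ s : ℝ,
      (1 + 2*a) ^ 4 * s ^ 4 + (2 * a ^ 2 * (1 + 2*a) ^ 2 - (1 + 2*a) ^ 4) * s ^ 2
        + a ^ 4 = 0 := by
  rintro ⟨s, hs⟩
  have h₁ : 0 < ((1 + 2*a) * s) ^ 2 + (1 + 2*a) * ((1 + 2*a) * s) + a ^ 2 := by
    nlinarith [sq_nonneg ((1 + 2*a) * s + (1 + 2*a) / 2)]
  have h₂ : 0 < ((1 + 2*a) * s) ^ 2 - (1 + 2*a) * ((1 + 2*a) * s) + a ^ 2 := by
    nlinarith [sq_nonneg ((1 + 2*a) * s - (1 + 2*a) / 2)]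
  refine (mul_pos h₁ h₂).ne' ?_
  linear_combination hs
end

section
/- Fix a > −1/2 and define ρ, λ and the profile curve c(s) = e^{λ(s)}·(tanh ρ(s), sech ρ(s)) as in the H = 1 natural parametrization. Then ρ is an even function, λ is an odd function, the Euclidean norm of c(s) equals e^{λ(s)}, and c(−s) = c(s)/‖c(s)‖² for all s; that is, the profile curve is symmetric under the Euclidean inversion through the unit circle (the geodesic radius). -/
open Real

theorem intervalIntegral_neg_of_even {f : ℝ → ℝ} (hf : ∀ t, f (-t) = f t) (s : ℝ) :
    ∫ t in (0 : ℝ)..(-s), f t = -∫ t in (0 : ℝ)..s, f t := by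
  have h := intervalIntegral.integral_comp_neg (a := 0) (b := s) f
  simp only [hf, neg_zero] at h
  rw [h, intervalIntegral.integral_symm]

theorem tanh_sq_add_one_div_cosh_sq (x : ℝ) :
    Real.tanh x ^ 2 + (1 / Real.cosh x) ^ 2 = 1 := by
  have hcosh : Real.cosh x ≠ 0 := (Real.cosh_pos x).ne'
  rw [Real.tanh_eq_sinh_div_cosh, div_pow, div_pow, one_pow, ← add_div, ← Real.cosh_sq,
    div_self (pow_ne_zero 2 hcosh)]

/-- Symmetry of the `H = 1` profile curve with respect to the geodesic radius: `ρ` is even,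
`λ` is odd, the Euclidean norm of `c(s) = e^{λ(s)}(tanh ρ(s), sech ρ(s))` is `e^{λ(s)}`, and
`c(−s) = c(s)/‖c(s)‖²`, i.e. the profile curve is symmetric under the Euclidean inversion
through the unit circle. -/
theorem profile_curve_symmetry_H_eq_one (a : ℝ) (ha : -1/2 < a)
    (U ρ lam : ℝ → ℝ) (c : ℝ → ℝ × ℝ)
    (hU : ∀ s, U s = Real.sqrt ((a ^ 2 + (1 + 2*a) ^ 2 * s ^ 2) / (1 + 2*a)))
    (hρ : ∀ s, ρ s = Real.arsinh (U s))
    (hlam : ∀ s, lam s = ∫ t in (0:ℝ)..s,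
      (Real.sqrt (1 + 2*a) * (-(a * (1 + a)) + (1 + 2*a) ^ 2 * t ^ 2)
          * Real.sqrt (a ^ 2 + (1 + 2*a) ^ 2 * t ^ 2))
        / ((-(a * (1 + a)) + (1 + 2*a) ^ 2 * t ^ 2) ^ 2 + (1 + 2*a) ^ 4 * t ^ 2))
    (hc : ∀ s, c s = (Real.exp (lam s) * Real.tanh (ρ s),
                      Real.exp (lam s) * (1 / Real.cosh (ρ s)))) :
    (∀ s, ρ (-s) = ρ s) ∧
    (∀ s, lam (-s) = - lam s) ∧
    (∀ s, Real.sqrt ((c s).1 ^ 2 + (c s).2 ^ 2) = Real.exp (lam s)) ∧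
    (∀ s, c (-s) = ((c s).1 / ((c s).1 ^ 2 + (c s).2 ^ 2),
                    (c s).2 / ((c s).1 ^ 2 + (c s).2 ^ 2))) := by
  have hρ_even : ∀ s, ρ (-s) = ρ s := fun s => by simp only [hρ, hU, neg_sq]
  have hlam_odd : ∀ s, lam (-s) = -lam s := fun s => by
    simp only [hlam]
    rw [intervalIntegral_neg_of_even (fun t => by simp only [neg_sq])]
  have hnorm_sq : ∀ s, (c s).1 ^ 2 + (c s).2 ^ 2 = Real.exp (lam s) ^ 2 := fun s => by
    simp only [hc, mul_pow, ← mul_add, tanh_sq_add_one_div_cosh_sq, mul_one]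
  refine ⟨hρ_even, hlam_odd, fun s => ?_, fun s => ?_⟩
  · rw [hnorm_sq, Real.sqrt_sq (Real.exp_pos _).le]
  · have hexp : Real.exp (lam s) ≠ 0 := Real.exp_ne_zero _
    rw [hnorm_sq, hc (-s), hc s, hρ_even, hlam_odd, Real.exp_neg]
    ext <;> field_simp
end

section
/- Fix −1/4 ≤ a < 0 and define U, ρ, λ as in the H = 1 natural parametrization, with λ'(s) equal to the integrand sqrt(1+2a)·(−a(1+a)+(1+2a)²s²)·sqrt(a²+(1+2a)²s²) / [(−a(1+a)+(1+2a)²s²)² + (1+2a)⁴s²]. Then λ'(s) > 0 for all s, and for every s ≥ 0 one has tanh(ρ(s))·λ'(s) + sech(ρ(s))²·ρ'(s) > 0; consequently no vertical tangency of the profile curve occurs at any parameter s ≥ 0. -/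
/-- For `-1/4 ≤ a < 0` in the `H = 1` natural parametrization, the derivative of `λ`
(given by the explicit integrand) is everywhere positive, and for every `s ≥ 0` the vertical
tangency expression `tanh(ρ(s))·λ'(s) + sech²(ρ(s))·ρ'(s)` is strictly positive; hence no
vertical tangency occurs at any parameter `s ≥ 0`. -/
theorem no_tangency_nonneg_H_eq_one (a : ℝ) (ha₁ : -1/4 ≤ a) (ha₂ : a < 0)
    (U ρ lam : ℝ → ℝ)
    (hU : ∀ s, U s = Real.sqrt ((a ^ 2 + (1 + 2*a) ^ 2 * s ^ 2) / (1 + 2*a)))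
    (hρ : ∀ s, ρ s = Real.arsinh (U s))
    (hlam' : ∀ s, deriv lam s =
      (Real.sqrt (1 + 2*a) * (-(a * (1 + a)) + (1 + 2*a) ^ 2 * s ^ 2)
          * Real.sqrt (a ^ 2 + (1 + 2*a) ^ 2 * s ^ 2))
        / ((-(a * (1 + a)) + (1 + 2*a) ^ 2 * s ^ 2) ^ 2 + (1 + 2*a) ^ 4 * s ^ 2)) :
    (∀ s, 0 < deriv lam s) ∧
    (∀ s, 0 ≤ s →
      0 < Real.tanh (ρ s) * deriv lam s + (1 / Real.cosh (ρ s)) ^ 2 * deriv ρ s) := by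
  have h12 : 0 < 1 + 2 * a := by linarith
  have ha_ne : a ≠ 0 := ha₂.ne
  have haa : 0 < -(a * (1 + a)) := by nlinarith
  have hpos : ∀ s, 0 < deriv lam s := by
    intro s
    rw [hlam']
    positivity
  refine ⟨hpos, fun s hs => ?_⟩
  have hρ_pos : 0 < ρ s := by
    rw [hρ, Real.arsinh_pos_iff, hU]
    positivity
  have htanh : 0 < Real.tanh (ρ s) := by
    rw [Real.tanh_eq_sinh_div_cosh]
    exact div_pos (Real.sinh_pos_iff.2 hρ_pos) (Real.cosh_pos _)
  have hρ_deriv : 0 ≤ deriv ρ s := by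
    have hρ_eq : ρ = fun t =>
        Real.arsinh (Real.sqrt ((a ^ 2 + (1 + 2*a) ^ 2 * t ^ 2) / (1 + 2*a))) := by
      funext t
      rw [hρ, hU]
    have hq : HasDerivAt (fun t : ℝ => (a ^ 2 + (1 + 2*a) ^ 2 * t ^ 2) / (1 + 2*a))
        ((1 + 2*a) ^ 2 * (2 * s) / (1 + 2*a)) s := by
      simpa using
        ((((hasDerivAt_id s).pow 2).const_mul ((1 + 2*a) ^ 2)).const_add (a ^ 2)).div_const
          (1 + 2*a)
    have hq_ne : (a ^ 2 + (1 + 2*a) ^ 2 * s ^ 2) / (1 + 2*a) ≠ 0 := by positivity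
    rw [hρ_eq, ((hq.sqrt hq_ne).arsinh).deriv, smul_eq_mul]
    positivity
  have := mul_pos htanh (hpos s)
  have := mul_nonneg (sq_nonneg (1 / Real.cosh (ρ s))) hρ_deriv
  linarith
end

section
/- For a = −1/4, with U, ρ, λ as in the H = 1 natural parametrization, the profile curve coordinates satisfy: e^{λ(s)}·tanh ρ(s) → 0 and e^{λ(s)}·sech ρ(s) → 0 as s → −∞, while e^{λ(s)}·tanh ρ(s) → +∞ and e^{λ(s)}·sech ρ(s) → +∞ as s → +∞. -/
open Filter

/-- The integrand of `λ` at `a = -1/4`, in simplified form. -/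
lemma integrand_eq (t : ℝ) :
    (Real.sqrt (1 + 2 * (-1/4)) * (-((-1/4) * (1 + (-1/4))) + (1 + 2 * (-1/4)) ^ 2 * t ^ 2)
          * Real.sqrt ((-1/4) ^ 2 + (1 + 2 * (-1/4)) ^ 2 * t ^ 2))
        / ((-((-1/4) * (1 + (-1/4))) + (1 + 2 * (-1/4)) ^ 2 * t ^ 2) ^ 2
          + (1 + 2 * (-1/4)) ^ 4 * t ^ 2)
      = 2 * √2 * (3 + 4 * t ^ 2) / (√(1 + 4 * t ^ 2) * (9 + 4 * t ^ 2)) := by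
  have h1 : √(1 + 2 * (-1/4) : ℝ) = √2 / 2 := by
    rw [Real.sqrt_eq_iff_mul_self_eq (by norm_num) (by positivity), div_mul_div_comm,
      Real.mul_self_sqrt (by norm_num)]
    norm_num
  have hw : 0 < √(1 + 4 * t ^ 2) := Real.sqrt_pos.2 (by positivity)
  have hw2 : √(1 + 4 * t ^ 2) ^ 2 = 1 + 4 * t ^ 2 := Real.sq_sqrt (by positivity)
  have h2 : √((-1/4) ^ 2 + (1 + 2 * (-1/4)) ^ 2 * t ^ 2) = √(1 + 4 * t ^ 2) / 4 := by
    rw [Real.sqrt_eq_iff_mul_self_eq (by positivity) (by positivity)]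
    linear_combination -hw2 / 16
  rw [h1, h2, div_eq_div_iff (by norm_num; positivity) (by positivity)]
  linear_combination (√2 / 8 * (3 / 16 + t ^ 2 / 4) * (9 + 4 * t ^ 2)) * hw2

/-- The simplified integrand dominates the derivative of `√2 / 2 * log (9 / 8 + t ^ 2 / 2)` in
absolute value. -/
lemma abs_le_integrand (t : ℝ) :
    |√2 / 2 * (t / (9 / 8 + t ^ 2 / 2))|
      ≤ 2 * √2 * (3 + 4 * t ^ 2) / (√(1 + 4 * t ^ 2) * (9 + 4 * t ^ 2)) := by
  have hw : 0 < √(1 + 4 * t ^ 2) := Real.sqrt_pos.2 (by positivity)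
  have hw2 : √(1 + 4 * t ^ 2) ^ 2 = 1 + 4 * t ^ 2 := Real.sq_sqrt (by positivity)
  have hd : 0 < 9 / 8 + t ^ 2 / 2 := by positivity
  have key : |t| * √(1 + 4 * t ^ 2) * 2 ≤ 3 + 4 * t ^ 2 := by
    nlinarith [sq_nonneg (2 * |t| - √(1 + 4 * t ^ 2)), sq_abs t]
  rw [abs_mul, abs_of_pos (by positivity : 0 < √2 / 2), abs_div, abs_of_pos hd]
  calc √2 / 2 * (|t| / (9 / 8 + t ^ 2 / 2))
      = 2 * √2 * (|t| * √(1 + 4 * t ^ 2) * 2) / (√(1 + 4 * t ^ 2) * (9 + 4 * t ^ 2)) := by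
        have : 9 / 8 + t ^ 2 / 2 = (9 + 4 * t ^ 2) / 8 := by ring
        rw [this]
        field_simp
        ring
    _ ≤ _ := by gcongr

lemma hasDerivAt_log_comparison (t : ℝ) :
    HasDerivAt (fun s : ℝ => √2 / 2 * Real.log (9 / 8 + s ^ 2 / 2))
      (√2 / 2 * (t / (9 / 8 + t ^ 2 / 2))) t := by
  have h : HasDerivAt (fun s : ℝ => 9 / 8 + s ^ 2 / 2) t t := by
    simpa using ((hasDerivAt_pow 2 t).div_const 2).const_add (9 / 8)
  exact (h.log (by positivity)).const_mul _

lemma tendsto_log_comparison {l : Filter ℝ} (hl : Tendsto (fun s : ℝ => |s|) l atTop) :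
    Tendsto (fun s : ℝ => Real.log (9 / 8 + s ^ 2 / 2)) l atTop := by
  refine Real.tendsto_log_atTop.comp (tendsto_atTop_add_const_left _ _ ?_)
  have := ((tendsto_pow_atTop (α := ℝ) two_ne_zero).comp hl).atTop_div_const (r := 2) (by norm_num)
  simpa [Function.comp_def] using this

/-- For `a = -1/4` in the `H = 1` natural parametrization, both coordinates
`e^{λ(s)}·tanh ρ(s)` and `e^{λ(s)}·sech ρ(s)` of the profile curve tend to `0` as `s → −∞`
and to `+∞` as `s → +∞`. -/
theorem profile_curve_limits_H_eq_one_a_eq_neg_quarter (a : ℝ) (ha : a = -1/4)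
    (U ρ lam : ℝ → ℝ)
    (hU : ∀ s, U s = Real.sqrt ((a ^ 2 + (1 + 2*a) ^ 2 * s ^ 2) / (1 + 2*a)))
    (hρ : ∀ s, ρ s = Real.arsinh (U s))
    (hlam : ∀ s, lam s = ∫ t in (0:ℝ)..s,
      (Real.sqrt (1 + 2*a) * (-(a * (1 + a)) + (1 + 2*a) ^ 2 * t ^ 2)
          * Real.sqrt (a ^ 2 + (1 + 2*a) ^ 2 * t ^ 2))
        / ((-(a * (1 + a)) + (1 + 2*a) ^ 2 * t ^ 2) ^ 2 + (1 + 2*a) ^ 4 * t ^ 2)) :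
    Tendsto (fun s => Real.exp (lam s) * Real.tanh (ρ s)) atBot (nhds 0) ∧
    Tendsto (fun s => Real.exp (lam s) * (1 / Real.cosh (ρ s))) atBot (nhds 0) ∧
    Tendsto (fun s => Real.exp (lam s) * Real.tanh (ρ s)) atTop atTop ∧
    Tendsto (fun s => Real.exp (lam s) * (1 / Real.cosh (ρ s))) atTop atTop := by
  subst ha
  simp only [integrand_eq] at hlam
  set h : ℝ → ℝ := fun s => √2 / 2 * Real.log (9 / 8 + s ^ 2 / 2) with h_def
  have hcont : Continuous fun t : ℝ =>
      2 * √2 * (3 + 4 * t ^ 2) / (√(1 + 4 * t ^ 2) * (9 + 4 * t ^ 2)) := by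
    refine Continuous.div (by fun_prop) (by fun_prop) fun t => ?_
    have : 0 < √(1 + 4 * t ^ 2) := Real.sqrt_pos.2 (by positivity)
    positivity
  have hderiv (s : ℝ) : HasDerivAt lam
      (2 * √2 * (3 + 4 * s ^ 2) / (√(1 + 4 * s ^ 2) * (9 + 4 * s ^ 2))) s := by
    rw [funext hlam]
    exact hcont.integral_hasStrictDerivAt 0 s |>.hasDerivAt
  have hlam0 : lam 0 = 0 := by simp [hlam]
  have mono_sub : Monotone fun s => lam s - h s :=
    monotone_of_hasDerivAt_nonneg (fun s => (hderiv s).sub (hasDerivAt_log_comparison s))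
      fun s => sub_nonneg.2 ((le_abs_self _).trans (abs_le_integrand s))
  have mono_add : Monotone fun s => lam s + h s :=
    monotone_of_hasDerivAt_nonneg (fun s => (hderiv s).add (hasDerivAt_log_comparison s))
      fun s => by
        have := (neg_abs_le _).trans' (neg_le_neg (abs_le_integrand s))
        simp only [Pi.zero_apply]
        linarith
  have hUsq (s : ℝ) : U s = √(1 / 8 + s ^ 2 / 2) := by
    rw [hU]; congr 1; ring
  have hcosh (s : ℝ) : Real.cosh (ρ s) = Real.exp (Real.log (9 / 8 + s ^ 2 / 2) / 2) := by
    rw [hρ, Real.cosh_arsinh, hUsq, Real.sq_sqrt (by positivity), Real.exp_half,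
      Real.exp_log (by positivity)]
    congr 1; ring
  have hsinh (s : ℝ) : Real.sinh (ρ s) = U s := by rw [hρ, Real.sinh_arsinh]
  have hbot : Tendsto (fun s => Real.exp (lam s)) atBot (nhds 0) := by
    refine Real.tendsto_exp_atBot.comp ?_
    have : Tendsto (fun s => h 0 - h s) atBot atBot :=
      tendsto_atBot_add_const_left _ _ (tendsto_neg_atTop_atBot.comp
        ((tendsto_log_comparison tendsto_abs_atBot_atTop).const_mul_atTop (by positivity)))
    refine tendsto_atBot_mono' _ ?_ this
    filter_upwards [eventually_le_atBot 0] with s hs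
    have := mono_add hs
    simp only [hlam0] at this
    linarith
  have htop : Tendsto (fun s => Real.exp (lam s) * (1 / Real.cosh (ρ s))) atTop atTop := by
    simp_rw [hcosh, one_div, ← Real.exp_neg, ← Real.exp_add]
    refine Real.tendsto_exp_atTop.comp ?_
    have hc : 0 < (√2 - 1) / 2 := by
      have : 1 < √2 := Real.one_lt_sqrt_two
      linarith
    refine tendsto_atTop_mono' _ ?_ (tendsto_atTop_add_const_left _ (-h 0)
      ((tendsto_log_comparison tendsto_abs_atTop_atTop).const_mul_atTop hc))
    filter_upwards [eventually_ge_atTop 0] with s hs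
    have := mono_sub hs
    simp only [hlam0, h_def] at this ⊢
    linarith
  refine ⟨?_, ?_, ?_, htop⟩
  · refine squeeze_zero_norm (fun s => ?_) hbot
    rw [norm_mul, Real.norm_of_nonneg (Real.exp_pos _).le, Real.norm_eq_abs]
    exact mul_le_of_le_one_right (Real.exp_pos _).le (Real.abs_tanh_lt_one _).le
  · refine squeeze_zero (fun s => ?_) (fun s => ?_) hbot
    · have := Real.cosh_pos (ρ s)
      positivity
    · refine mul_le_of_le_one_right (Real.exp_pos _).le ?_
      exact (div_le_one (Real.cosh_pos _)).2 (Real.one_le_cosh _)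
  · refine tendsto_atTop_mono (fun s => ?_) (htop.const_mul_atTop
      (Real.sqrt_pos.2 (by norm_num : (0 : ℝ) < 1 / 8)))
    have hle : √(1 / 8) ≤ U s := by
      rw [hUsq]
      exact Real.sqrt_le_sqrt (by nlinarith [sq_nonneg s])
    have := Real.cosh_pos (ρ s)
    calc √(1 / 8) * (Real.exp (lam s) * (1 / Real.cosh (ρ s)))
        ≤ U s * (Real.exp (lam s) * (1 / Real.cosh (ρ s))) := by gcongr
      _ = Real.exp (lam s) * Real.tanh (ρ s) := by
        rw [Real.tanh_eq_sinh_div_cosh, hsinh]; ring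
end

section
/- Fix a > 0 and define the profile curve c(s) = e^{λ(s)}·(tanh ρ(s), sech ρ(s)) as in the H = 1 natural parametrization. If c(s_i) = c(s_j) for real numbers s_i, s_j, then s_j = s_i or s_j = −s_i; in particular any self-intersection of the profile curve occurs on the geodesic radius, at a pair of parameters ±s with λ(s) = 0. -/
/-- For `a > 0`, self-intersections of the `H = 1` profile curve
`c(s) = e^{λ(s)}(tanh ρ(s), sech ρ(s))` can occur only at pairs of parameters `±s`; any genuine
self-intersection lies on the geodesic radius, i.e. `λ(s) = 0` there. -/
theorem self_intersection_H_eq_one (a : ℝ) (ha : 0 < a)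
    (U ρ lam : ℝ → ℝ) (c : ℝ → ℝ × ℝ)
    (hU : ∀ s, U s = Real.sqrt ((a ^ 2 + (1 + 2*a) ^ 2 * s ^ 2) / (1 + 2*a)))
    (hρ : ∀ s, ρ s = Real.arsinh (U s))
    (hlam : ∀ s, lam s = ∫ t in (0:ℝ)..s,
      (Real.sqrt (1 + 2*a) * (-(a * (1 + a)) + (1 + 2*a) ^ 2 * t ^ 2)
          * Real.sqrt (a ^ 2 + (1 + 2*a) ^ 2 * t ^ 2))
        / ((-(a * (1 + a)) + (1 + 2*a) ^ 2 * t ^ 2) ^ 2 + (1 + 2*a) ^ 4 * t ^ 2))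
    (hc : ∀ s, c s = (Real.exp (lam s) * Real.tanh (ρ s),
                      Real.exp (lam s) * (1 / Real.cosh (ρ s))))
    (si sj : ℝ) (hij : c si = c sj) :
    sj = si ∨ (sj = -si ∧ lam si = 0) := by
  have hD : 0 < 1 + 2 * a := by linarith
  rw [hc, hc, Prod.mk.injEq] at hij
  obtain ⟨h1, h2⟩ := hij
  rw [Real.tanh_eq_sinh_div_cosh, Real.tanh_eq_sinh_div_cosh] at h1
  have hpos : 0 < Real.exp (lam sj) * (1 / Real.cosh (ρ sj)) := by
    have := Real.cosh_pos (ρ sj)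
    positivity
  have hUU : U si = U sj := by
    rw [hρ, hρ, Real.sinh_arsinh, Real.sinh_arsinh, ← hρ, ← hρ] at h1
    refine mul_right_cancel₀ hpos.ne' ?_
    calc U si * (Real.exp (lam sj) * (1 / Real.cosh (ρ sj)))
        = U si * (Real.exp (lam si) * (1 / Real.cosh (ρ si))) := by rw [h2]
      _ = Real.exp (lam si) * (U si / Real.cosh (ρ si)) := by ring
      _ = Real.exp (lam sj) * (U sj / Real.cosh (ρ sj)) := h1
      _ = U sj * (Real.exp (lam sj) * (1 / Real.cosh (ρ sj))) := by ring
  have hsq : sj ^ 2 = si ^ 2 := by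
    have h := hUU
    rw [hU, hU, Real.sqrt_inj (by positivity) (by positivity), div_left_inj' hD.ne',
      add_right_inj] at h
    exact (mul_left_cancel₀ (pow_pos hD 2).ne' h).symm
  have hlam_eq : lam si = lam sj := by
    rw [hρ si, hUU, ← hρ sj] at h2
    have hcosh := Real.cosh_pos (ρ sj)
    exact Real.exp_injective (mul_right_cancel₀ (one_div_pos.mpr hcosh).ne' h2)
  refine (sq_eq_sq_iff_eq_or_eq_neg.mp hsq).imp_right fun hneg => ⟨hneg, ?_⟩
  have hodd : lam (-si) = -lam si := by
    rw [hlam, hlam, intervalIntegral.integral_symm]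
    congr 1
    rw [← neg_zero, ← intervalIntegral.integral_comp_neg]
    simp only [neg_sq, neg_zero]
  rw [hneg, hodd] at hlam_eq
  linarith
end

section
/- Fix 0 < H < 1 and a ≠ 0; set A = 1+2aH, B = sqrt(1+4aH+4a²), α = sqrt(1−H²), and U(s) = sqrt((−A + B·cosh(2αs))/(2α²)). Then the radicand −A + B·cosh(2αs) is positive for all s, U is differentiable with U'(s)² = B²·sinh²(2αs)/(2(−A + B·cosh(2αs))), and U(s)² = U'(s)² holds if and only if B²H²·cosh²(2αs) − 2AB·cosh(2αs) + A² + α²B² = 0. -/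
/-- For `0 < H < 1` and `a ≠ 0`, with `A = 1+2aH`, `B = √(1+4aH+4a²)`, `α = √(1−H²)` and
`U(s) = √((−A + B cosh(2αs))/(2α²))`: the radicand `−A + B cosh(2αs)` is everywhere positive,
`U` is differentiable with `U'(s)² = B² sinh²(2αs)/(2(−A + B cosh(2αs)))`, and the vertical
tangency condition `U(s)² = U'(s)²` holds iff
`B²H² cosh²(2αs) − 2AB cosh(2αs) + A² + α²B² = 0`. -/
theorem tangency_equation_H_lt_one (H a A B α : ℝ)
    (hH₀ : 0 < H) (hH₁ : H < 1) (ha : a ≠ 0)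
    (hA : A = 1 + 2*a*H) (hB : B = Real.sqrt (1 + 4*a*H + 4*a ^ 2))
    (hα : α = Real.sqrt (1 - H ^ 2))
    (U : ℝ → ℝ)
    (hU : ∀ s, U s = Real.sqrt ((-A + B * Real.cosh (2*α*s)) / (2 * α ^ 2))) :
    (∀ s : ℝ, 0 < -A + B * Real.cosh (2*α*s)) ∧
    (∀ s : ℝ, DifferentiableAt ℝ U s ∧
      (deriv U s) ^ 2 =
        B ^ 2 * Real.sinh (2*α*s) ^ 2 / (2 * (-A + B * Real.cosh (2*α*s))) ∧
      ((U s) ^ 2 = (deriv U s) ^ 2 ↔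
        B ^ 2 * H ^ 2 * Real.cosh (2*α*s) ^ 2 - 2 * A * B * Real.cosh (2*α*s)
          + A ^ 2 + α ^ 2 * B ^ 2 = 0)) := by
  have hα_pos : 0 < α := by
    rw [hα]
    exact Real.sqrt_pos.mpr (by nlinarith)
  have hα_sq : α ^ 2 = 1 - H ^ 2 := by
    rw [hα]
    exact Real.sq_sqrt (by nlinarith)
  have hA_lt_B : A < B := by
    rw [hB]
    refine Real.lt_sqrt_of_sq_lt ?_
    rw [hA]
    have ha_sq : 0 < a ^ 2 := by positivity
    nlinarith [mul_pos ha_sq (show 0 < 1 - H ^ 2 by nlinarith)]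
  have hB_nonneg : 0 ≤ B := hB ▸ Real.sqrt_nonneg _
  have radicand_pos : ∀ s : ℝ, 0 < -A + B * Real.cosh (2*α*s) := fun s => by
    nlinarith [mul_le_mul_of_nonneg_left (Real.one_le_cosh (2*α*s)) hB_nonneg]
  refine ⟨radicand_pos, fun s => ?_⟩
  have hR := radicand_pos s
  have hQ : 0 < (-A + B * Real.cosh (2*α*s)) / (2 * α ^ 2) := by positivity
  have hasDeriv_radicand : HasDerivAt
      (fun t => (-A + B * Real.cosh (2*α*t)) / (2 * α ^ 2))
      (B * (Real.sinh (2*α*s) * (2*α)) / (2 * α ^ 2)) s := by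
    have hlin : HasDerivAt (fun t : ℝ => 2*α*t) (2*α) s := by
      simpa using (hasDerivAt_id s).const_mul (2*α)
    exact ((hlin.cosh.const_mul B).const_add (-A)).div_const _
  have hasDeriv_U := hasDeriv_radicand.sqrt hQ.ne'
  rw [← funext hU] at hasDeriv_U
  have hU_sq : U s ^ 2 = (-A + B * Real.cosh (2*α*s)) / (2 * α ^ 2) := by
    rw [hU, Real.sq_sqrt hQ.le]
  have deriv_sq : deriv U s ^ 2 =
      B ^ 2 * Real.sinh (2*α*s) ^ 2 / (2 * (-A + B * Real.cosh (2*α*s))) := by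
    rw [hasDeriv_U.deriv, div_pow, mul_pow 2, Real.sq_sqrt hQ.le]
    field_simp
  refine ⟨hasDeriv_U.differentiableAt, deriv_sq, ?_⟩
  rw [hU_sq, deriv_sq, div_eq_div_iff (by positivity) (by positivity), Real.sinh_sq, hα_sq]
  constructor <;> intro h <;> linarith
end

section
/- Fix 0 < H < 1 and a ∈ ℝ; set A = 1+2aH, B = sqrt(1+4aH+4a²), α = sqrt(1−H²). Consider the equation B²H²·cosh²(2αs) − 2AB·cosh(2αs) + A² + α²B² = 0 in the real variable s. (i) If a < −1/(4H), it has no real solution. (ii) If a = −1/(4H), its solution set is exactly {(1/(2α))·arccosh(1/H), −(1/(2α))·arccosh(1/H)}. (iii) If a > −1/(4H), its solution set is exactly {±(1/(2α))·arccosh((A+(1−H²)·sqrt(1+4aH))/(BH²)), ±(1/(2α))·arccosh((A−(1−H²)·sqrt(1+4aH))/(BH²))}. -/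
/-- The inverse hyperbolic cosine, `arccosh x = log (x + √(x² − 1))`. -/
noncomputable def arccosh (x : ℝ) : ℝ := Real.log (x + Real.sqrt (x ^ 2 - 1))

/-- Solutions of `cosh (2αs) = x` for `α > 0` and `x ≥ 1`. -/
theorem cosh_two_mul_mul_eq_iff {α x : ℝ} (hα : 0 < α) (hx : 1 ≤ x) (s : ℝ) :
    Real.cosh (2*α*s) = x ↔
      s = 1/(2*α) * arccosh x ∨ s = -(1/(2*α) * arccosh x) := by
  have key : Real.cosh (2*α*s) = x ↔ |2*α*s| = arccosh x := by
    change _ ↔ _ = Real.arcosh x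
    constructor
    · intro h
      rw [← h, ← Real.cosh_abs, Real.arcosh_cosh (abs_nonneg _)]
    · intro h
      rw [← Real.cosh_abs, h, Real.cosh_arcosh hx]
  have hnn : 0 ≤ arccosh x := Real.arcosh_nonneg hx
  rw [key, abs_eq hnn]
  refine or_congr ?_ ?_ <;> constructor <;> intro h
  · rw [← h]
    field_simp
  · rw [h]
    field_simp
  · rw [← neg_eq_iff_eq_neg.mpr h]
    field_simp
  · rw [h]
    field_simp

/-- Completing the square in the tangency equation. -/
theorem tangency_complete_square (H a B c : ℝ) (hB : B ^ 2 = 1 + 4*a*H + 4*a ^ 2) :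
    H ^ 2 * (B ^ 2 * H ^ 2 * c ^ 2 - 2 * (1 + 2*a*H) * B * c
        + (1 + 2*a*H) ^ 2 + (1 - H ^ 2) * B ^ 2)
      = (B * H ^ 2 * c - (1 + 2*a*H)) ^ 2 - (1 - H ^ 2) ^ 2 * (1 + 4*a*H) := by
  linear_combination H ^ 2 * (1 - H ^ 2) * hB

/-- The smaller root of the tangency quadratic in `cosh (2αs)` is at least one. -/
theorem mul_sq_le_sub_mul_sqrt {H a B t : ℝ} (hH₀ : 0 < H) (hH₁ : H < 1)
    (hB : B ^ 2 = 1 + 4*a*H + 4*a ^ 2) (ht₀ : 0 ≤ t) (ht : t ^ 2 = 1 + 4*a*H) :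
    B * H ^ 2 ≤ (1 + 2*a*H) - (1 - H ^ 2) * t := by
  have hL : (1 + 2*a*H) - (1 - H ^ 2) * t = (1 - t) ^ 2 / 2 + H ^ 2 * t := by
    linear_combination (-1/2) * ht
  have hH2 : 0 ≤ 1 - H ^ 2 := by nlinarith
  rw [hL]
  refine abs_le_of_sq_le_sq' ?_ (by positivity) |>.2
  have haH : a * H = (t ^ 2 - 1) / 4 := by linear_combination (-1/4) * ht
  have hBH : (B * H ^ 2) ^ 2 = H ^ 4 * t ^ 2 + H ^ 2 * (t ^ 2 - 1) ^ 2 / 4 := by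
    linear_combination H ^ 4 * hB - H ^ 4 * ht + 4 * H ^ 2 * (a * H + (t ^ 2 - 1) / 4) * haH
  have hpos : 0 ≤ (1 - t) ^ 4 * (1 - H ^ 2) / 4 := by positivity
  rw [hBH]
  linarith [show ((1 - t) ^ 2 / 2 + H ^ 2 * t) ^ 2
    - (H ^ 4 * t ^ 2 + H ^ 2 * (t ^ 2 - 1) ^ 2 / 4) = (1 - t) ^ 4 * (1 - H ^ 2) / 4 by ring]

/-- For `0 < H < 1`, `A = 1+2aH`, `B = √(1+4aH+4a²)`, `α = √(1−H²)`, the vertical tangency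
equation `B²H² cosh²(2αs) − 2AB cosh(2αs) + A² + α²B² = 0`:
(i) has no real solution when `a < −1/(4H)`;
(ii) has solution set `{±(1/(2α))·arccosh(1/H)}` when `a = −1/(4H)`;
(iii) has solution set `{±(1/(2α))·arccosh((A+(1−H²)√(1+4aH))/(BH²)),
±(1/(2α))·arccosh((A−(1−H²)√(1+4aH))/(BH²))}` when `a > −1/(4H)`. -/
theorem tangency_solutions_H_lt_one (H a A B α : ℝ)
    (hH₀ : 0 < H) (hH₁ : H < 1)
    (hA : A = 1 + 2*a*H) (hB : B = Real.sqrt (1 + 4*a*H + 4*a ^ 2))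
    (hα : α = Real.sqrt (1 - H ^ 2)) :
    (a < -1/(4*H) →
      ¬ ∃ s : ℝ, B ^ 2 * H ^ 2 * Real.cosh (2*α*s) ^ 2 - 2 * A * B * Real.cosh (2*α*s)
          + A ^ 2 + α ^ 2 * B ^ 2 = 0) ∧
    (a = -1/(4*H) →
      {s : ℝ | B ^ 2 * H ^ 2 * Real.cosh (2*α*s) ^ 2 - 2 * A * B * Real.cosh (2*α*s)
          + A ^ 2 + α ^ 2 * B ^ 2 = 0}
        = {1/(2*α) * arccosh (1/H), -(1/(2*α) * arccosh (1/H))}) ∧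
    (-1/(4*H) < a →
      {s : ℝ | B ^ 2 * H ^ 2 * Real.cosh (2*α*s) ^ 2 - 2 * A * B * Real.cosh (2*α*s)
          + A ^ 2 + α ^ 2 * B ^ 2 = 0}
        = {1/(2*α) * arccosh ((A + (1 - H ^ 2) * Real.sqrt (1 + 4*a*H)) / (B * H ^ 2)),
           -(1/(2*α) * arccosh ((A + (1 - H ^ 2) * Real.sqrt (1 + 4*a*H)) / (B * H ^ 2))),
           1/(2*α) * arccosh ((A - (1 - H ^ 2) * Real.sqrt (1 + 4*a*H)) / (B * H ^ 2)),
           -(1/(2*α) * arccosh ((A - (1 - H ^ 2) * Real.sqrt (1 + 4*a*H)) / (B * H ^ 2)))}) := by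
  have hH2 : 0 < 1 - H ^ 2 := by nlinarith
  have hα₀ : 0 < α := hα ▸ Real.sqrt_pos.mpr hH2
  have hα2 : α ^ 2 = 1 - H ^ 2 := by rw [hα, Real.sq_sqrt hH2.le]
  have hpos : 0 < 1 + 4*a*H + 4*a ^ 2 := by
    by_cases ha : a = 0
    · simp [ha]
    · have : 0 < a ^ 2 := by positivity
      nlinarith [sq_nonneg (1 + 2*a*H), mul_pos this hH2]
  have hB₀ : 0 < B := hB ▸ Real.sqrt_pos.mpr hpos
  have hB2 : B ^ 2 = 1 + 4*a*H + 4*a ^ 2 := by rw [hB, Real.sq_sqrt hpos.le]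
  have hBH : 0 < B * H ^ 2 := by positivity
  have heq (c : ℝ) : B ^ 2 * H ^ 2 * c ^ 2 - 2 * A * B * c + A ^ 2 + α ^ 2 * B ^ 2 = 0 ↔
      (B * H ^ 2 * c - A) ^ 2 - (1 - H ^ 2) ^ 2 * (1 + 4*a*H) = 0 := by
    rw [hα2, hA, ← tangency_complete_square H a B c hB2]
    simp [hH₀.ne']
  clear hB hα
  simp only [heq]
  refine ⟨?_, ?_, ?_⟩
  · rintro ha ⟨s, hs⟩
    rw [lt_div_iff₀ (by positivity)] at ha
    have : 0 < (1 - H ^ 2) ^ 2 * (-(1 + 4*a*H)) := mul_pos (by positivity) (by linarith)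
    nlinarith [sq_nonneg (B * H ^ 2 * Real.cosh (2*α*s) - A)]
  · intro ha
    have haH : a * H = -1/4 := by
      rw [ha]
      field_simp
    have hA' : A = 1/2 := by linarith
    have hBH' : B * H = 1/2 := by
      have : (B * H) ^ 2 = (1/2) ^ 2 := by
        linear_combination H ^ 2 * hB2 + 4 * (H ^ 2 + a * H - 1/4) * haH
      exact (sq_eq_sq₀ (by positivity) (by norm_num)).mp this
    ext s
    have hx : 1 ≤ 1/H := by
      rw [le_div_iff₀ hH₀]
      linarith
    simp only [Set.mem_ofPred_eq, Set.mem_insert_iff, Set.mem_singleton_iff]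
    rw [← cosh_two_mul_mul_eq_iff hα₀ hx, eq_div_iff hH₀.ne', hA',
      show 1 + 4*a*H = 0 by linarith, mul_zero, sub_zero, sq_eq_zero_iff,
      show B * H ^ 2 * Real.cosh (2*α*s) = 1/2 * (Real.cosh (2*α*s) * H) by
        rw [← hBH']
        ring]
    constructor <;> intro h <;> linarith
  · intro ha
    rw [div_lt_iff₀ (by positivity)] at ha
    have ht₀ := Real.sqrt_nonneg (1 + 4*a*H)
    have ht := Real.sq_sqrt (show 0 ≤ 1 + 4*a*H by linarith)
    set t := Real.sqrt (1 + 4*a*H)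
    have hle := mul_sq_le_sub_mul_sqrt hH₀ hH₁ hB2 ht₀ ht
    rw [← hA] at hle
    have hx₂ : 1 ≤ (A - (1 - H ^ 2) * t) / (B * H ^ 2) := by
      rwa [one_le_div hBH]
    have hx₁ : 1 ≤ (A + (1 - H ^ 2) * t) / (B * H ^ 2) := by
      rw [one_le_div hBH]
      linarith [mul_nonneg hH2.le ht₀]
    ext s
    simp only [Set.mem_ofPred_eq, Set.mem_insert_iff, Set.mem_singleton_iff]
    rw [← or_assoc, ← cosh_two_mul_mul_eq_iff hα₀ hx₁, ← cosh_two_mul_mul_eq_iff hα₀ hx₂,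
      eq_div_iff hBH.ne', eq_div_iff hBH.ne', ← ht, ← mul_pow,
      sub_eq_zero, sq_eq_sq_iff_eq_or_eq_neg]
    refine or_congr ?_ ?_ <;> constructor <;> intro h <;> linarith
end

section
/- Fix 0 ≤ H < 1 and a ≠ 0, and define U, ρ, λ as in the 0 ≤ H < 1 natural parametrization. Then U(s) → +∞ as |s| → ∞, λ(s) converges to a finite limit as s → +∞ and to a finite limit as s → −∞ (in particular λ is bounded), and consequently e^{λ(s)}·sech ρ(s) → 0 as |s| → ∞; that is, the asymptotic boundary of the profile curve c(s) = e^{λ(s)}·(tanh ρ(s), sech ρ(s)) consists of at most two points of the line z = 0. -/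
open Filter

/-- The integrand of `λ`. -/
noncomputable def lamIntegrand (H a A B α t : ℝ) : ℝ :=
  (Real.sqrt 2 * α * (-(2*a) + H * (-1 + B * Real.cosh (2*α*t)))
      * Real.sqrt (-A + B * Real.cosh (2*α*t)))
    / ((-(2*a) + H * (-1 + B * Real.cosh (2*α*t))) ^ 2
        + α ^ 2 * B ^ 2 * Real.sinh (2*α*t) ^ 2)

lemma lamIntegrand_neg (H a A B α t : ℝ) :
    lamIntegrand H a A B α (-t) = lamIntegrand H a A B α t := by
  simp [lamIntegrand]

lemma lamIntegrand_denom_pos {H a B α : ℝ} (hα : 0 < α) (hα2 : α ^ 2 = 1 - H ^ 2) (ha : a ≠ 0)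
    (hB : 0 < B) (hB2 : B ^ 2 = 1 + 4*a*H + 4*a ^ 2) (t : ℝ) :
    0 < (-(2*a) + H * (-1 + B * Real.cosh (2*α*t))) ^ 2
        + α ^ 2 * B ^ 2 * Real.sinh (2*α*t) ^ 2 := by
  rcases eq_or_ne t 0 with rfl | ht
  · simp only [mul_zero, Real.cosh_zero, Real.sinh_zero, mul_one]
    have hne : -(2*a) + H * (-1 + B) ≠ 0 := by
      intro h
      have hHB : H * B = 2*a + H := by linarith
      have hsq : H ^ 2 * B ^ 2 = (2*a + H) ^ 2 := by rw [← hHB]; ring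
      have hprod : a * (α ^ 2 * (a + H)) = 0 := by
        rw [hB2] at hsq
        rw [hα2]
        linear_combination (-1/4) * hsq
      have haH : a = -H := by
        rcases mul_eq_zero.1 hprod with h1 | h1
        · exact absurd h1 ha
        · rcases mul_eq_zero.1 h1 with h2 | h2
          · exact absurd h2 (by positivity)
          · linarith
      have hB1 : B = 1 := by
        have : B ^ 2 = 1 := by rw [hB2, haH]; ring
        nlinarith
      apply ha
      rw [hB1] at h
      linarith
    positivity
  · have hs : Real.sinh (2*α*t) ≠ 0 := by
      rw [Ne, Real.sinh_eq_zero]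
      positivity
    positivity

lemma lamIntegrand_continuous {H a A B α : ℝ} (hα : 0 < α) (hα2 : α ^ 2 = 1 - H ^ 2)
    (ha : a ≠ 0) (hB : 0 < B) (hB2 : B ^ 2 = 1 + 4*a*H + 4*a ^ 2) :
    Continuous (lamIntegrand H a A B α) := by
  unfold lamIntegrand
  refine Continuous.div (by fun_prop) (by fun_prop) fun t => ?_
  exact (lamIntegrand_denom_pos hα hα2 ha hB hB2 t).ne'

lemma lamIntegrand_isBigO {H a A B α : ℝ} (hH : 0 ≤ H) (hα : 0 < α) (hB : 0 < B) :
    lamIntegrand H a A B α =O[atTop] fun t => Real.exp (-α * t) := by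
  refine Asymptotics.IsBigO.of_bound
    ((Real.sqrt 2 * α * (2*|a| + H + H*B) * Real.sqrt (|A| + B)) / (α ^ 2 * B ^ 2 / 16)) ?_
  filter_upwards [eventually_ge_atTop (1/α)] with t ht
  have hαt : 1 ≤ α * t := by
    rw [div_le_iff₀ hα] at ht
    linarith
  set x := Real.exp (α * t) with hx
  have hx2 : 2 ≤ x := by
    have := Real.add_one_le_exp (α * t)
    linarith
  have hxp : 0 < x := by positivity
  have hexp : Real.exp (2*α*t) = x ^ 2 := by
    rw [hx, ← Real.exp_nat_mul]; congr 1; push_cast; ring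
  have hexpn : Real.exp (-(2*α*t)) ≤ 1 := Real.exp_le_one_iff.2 (by linarith)
  have hcosh : Real.cosh (2*α*t) ≤ x ^ 2 := by
    rw [Real.cosh_eq, hexp]; nlinarith
  have hcosh0 : 1 ≤ Real.cosh (2*α*t) := Real.one_le_cosh _
  have hsinh : x ^ 2 / 4 ≤ Real.sinh (2*α*t) := by
    rw [Real.sinh_eq, hexp]; nlinarith
  have hden : α ^ 2 * B ^ 2 / 16 * x ^ 4 ≤
      (-(2*a) + H * (-1 + B * Real.cosh (2*α*t))) ^ 2
        + α ^ 2 * B ^ 2 * Real.sinh (2*α*t) ^ 2 := by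
    have h1 : (x ^ 2 / 4) ^ 2 ≤ Real.sinh (2*α*t) ^ 2 := by gcongr
    have h2 := mul_le_mul_of_nonneg_left h1 (by positivity : 0 ≤ α ^ 2 * B ^ 2)
    nlinarith [sq_nonneg (-(2*a) + H * (-1 + B * Real.cosh (2*α*t)))]
  have hx1 : 1 ≤ x ^ 2 := by nlinarith
  have hfac : |-(2*a) + H * (-1 + B * Real.cosh (2*α*t))| ≤ (2*|a| + H + H*B) * x ^ 2 := by
    have h1 : H * B * Real.cosh (2*α*t) ≤ H * B * x ^ 2 := by gcongr
    have h2 : 0 ≤ H * B * Real.cosh (2*α*t) := by positivity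
    have h3 : |a| ≤ |a| * x ^ 2 := le_mul_of_one_le_right (abs_nonneg a) hx1
    have h4 : H ≤ H * x ^ 2 := le_mul_of_one_le_right hH hx1
    rw [abs_le]
    constructor <;> nlinarith [neg_abs_le a, le_abs_self a]
  have hsqrt : Real.sqrt (-A + B * Real.cosh (2*α*t)) ≤ Real.sqrt (|A| + B) * x := by
    rw [← Real.sqrt_sq hxp.le, ← Real.sqrt_mul (by positivity)]
    apply Real.sqrt_le_sqrt
    have h1 : B * Real.cosh (2*α*t) ≤ B * x ^ 2 := by gcongr
    have h2 : |A| ≤ |A| * x ^ 2 := le_mul_of_one_le_right (abs_nonneg A) hx1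
    linarith [neg_le_abs A]
  have hxinv : Real.exp (-α * t) = x⁻¹ := by
    rw [hx, ← Real.exp_neg]; congr 1; ring
  have hDpos : 0 < α ^ 2 * B ^ 2 / 16 * x ^ 4 := by positivity
  rw [hxinv, Real.norm_eq_abs, Real.norm_eq_abs, abs_of_pos (inv_pos.2 hxp), lamIntegrand,
    abs_div, abs_of_pos (hDpos.trans_le hden), abs_mul, abs_mul, abs_of_nonneg (Real.sqrt_nonneg _),
    abs_of_nonneg (by positivity : 0 ≤ Real.sqrt 2 * α)]
  calc _ ≤ (Real.sqrt 2 * α * ((2*|a| + H + H*B) * x ^ 2) * (Real.sqrt (|A| + B) * x))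
        / (α ^ 2 * B ^ 2 / 16 * x ^ 4) := by gcongr
    _ = _ := by field_simp

lemma tendsto_exp_mul_sech_arsinh {l : Filter ℝ} {f U : ℝ → ℝ} {L : ℝ}
    (hf : Tendsto f l (nhds L)) (hU : Tendsto U l atTop) :
    Tendsto (fun s => Real.exp (f s) * (1 / Real.cosh (Real.arsinh (U s)))) l (nhds 0) := by
  have hcosh : Tendsto (fun s => Real.cosh (Real.arsinh (U s))) l atTop := by
    refine tendsto_atTop_mono (fun s => ?_) hU
    rw [Real.cosh_arsinh]
    exact Real.le_sqrt_of_sq_le (by linarith)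
  have := ((Real.continuous_exp.tendsto L).comp hf).mul hcosh.inv_tendsto_atTop
  simpa using this

lemma tendsto_sqrt_cosh_atTop {A B α : ℝ} (hα : 0 < α) (hB : 0 < B) :
    Tendsto (fun s => Real.sqrt ((-A + B * Real.cosh (2*α*s)) / (2 * α ^ 2))) atTop atTop := by
  have hlin : Tendsto (fun s : ℝ => 2*α*s) atTop atTop :=
    tendsto_id.const_mul_atTop (by positivity)
  have hcosh : Tendsto (fun s => Real.cosh (2*α*s)) atTop atTop :=
    tendsto_atTop_mono (fun s => by
      rw [← Real.cosh_abs]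
      exact (le_abs_self _).trans ((Real.self_le_sinh_iff.2 (abs_nonneg _)).trans
        (Real.sinh_lt_cosh _).le)) hlin
  exact Real.tendsto_sqrt_atTop.comp
    ((tendsto_atTop_add_const_left _ (-A) (hcosh.const_mul_atTop hB)).atTop_div_const
      (by positivity))

/-- For `0 ≤ H < 1` and `a ≠ 0`: `U(s) → +∞` as `s → ±∞`, `λ` converges to a finite limit
both as `s → +∞` and as `s → −∞`, and consequently the second coordinate
`e^{λ(s)}·sech ρ(s)` of the profile curve tends to `0` as `s → ±∞`: the asymptotic boundary
of the profile curve consists of at most two points of the line `z = 0`. -/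
theorem profile_curve_asymptotics_H_lt_one (H a A B α : ℝ)
    (hH₀ : 0 ≤ H) (hH₁ : H < 1) (ha : a ≠ 0)
    (hA : A = 1 + 2*a*H) (hB : B = Real.sqrt (1 + 4*a*H + 4*a ^ 2))
    (hα : α = Real.sqrt (1 - H ^ 2))
    (U ρ lam : ℝ → ℝ)
    (hU : ∀ s, U s = Real.sqrt ((-A + B * Real.cosh (2*α*s)) / (2 * α ^ 2)))
    (hρ : ∀ s, ρ s = Real.arsinh (U s))
    (hlam : ∀ s, lam s = ∫ t in (0:ℝ)..s,
      (Real.sqrt 2 * α * (-(2*a) + H * (-1 + B * Real.cosh (2*α*t)))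
          * Real.sqrt (-A + B * Real.cosh (2*α*t)))
        / ((-(2*a) + H * (-1 + B * Real.cosh (2*α*t))) ^ 2
            + α ^ 2 * B ^ 2 * Real.sinh (2*α*t) ^ 2)) :
    Tendsto U atTop atTop ∧ Tendsto U atBot atTop ∧
    (∃ L : ℝ, Tendsto lam atTop (nhds L)) ∧
    (∃ L' : ℝ, Tendsto lam atBot (nhds L')) ∧
    Tendsto (fun s => Real.exp (lam s) * (1 / Real.cosh (ρ s))) atTop (nhds 0) ∧
    Tendsto (fun s => Real.exp (lam s) * (1 / Real.cosh (ρ s))) atBot (nhds 0) := by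
  have hα_pos : 0 < α := hα ▸ Real.sqrt_pos.2 (by nlinarith)
  have hα2 : α ^ 2 = 1 - H ^ 2 := by rw [hα, Real.sq_sqrt (by nlinarith)]
  have hB_arg : 0 < 1 + 4*a*H + 4*a ^ 2 := by nlinarith [sq_nonneg (2*a + H)]
  have hB_pos : 0 < B := hB ▸ Real.sqrt_pos.2 hB_arg
  have hB2 : B ^ 2 = 1 + 4*a*H + 4*a ^ 2 := by rw [hB, Real.sq_sqrt hB_arg.le]
  have hU_top : Tendsto U atTop atTop := by
    rw [funext hU]
    exact tendsto_sqrt_cosh_atTop hα_pos hB_pos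
  have hU_bot : Tendsto U atBot atTop := by
    refine (hU_top.comp tendsto_neg_atBot_atTop).congr fun s => ?_
    simp [hU]
  have hlam' : ∀ s, lam s = ∫ t in (0:ℝ)..s, lamIntegrand H a A B α t := hlam
  have hlam_neg : ∀ s, -lam (-s) = lam s := by
    intro s
    have h := intervalIntegral.integral_comp_neg (a := 0) (b := s) (lamIntegrand H a A B α)
    simp only [lamIntegrand_neg, neg_zero] at h
    rw [hlam', hlam', h, intervalIntegral.integral_symm, neg_neg]
  obtain ⟨L, hL⟩ : ∃ L : ℝ, Tendsto lam atTop (nhds L) := by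
    rw [funext hlam']
    exact ⟨_, MeasureTheory.intervalIntegral_tendsto_integral_Ioi 0
      (integrable_of_isBigO_exp_neg hα_pos
        (lamIntegrand_continuous hα_pos hα2 ha hB_pos hB2).continuousOn
        (lamIntegrand_isBigO hH₀ hα_pos hB_pos)) tendsto_id⟩
  have hL_bot : Tendsto lam atBot (nhds (-L)) :=
    (hL.comp tendsto_neg_atBot_atTop).neg.congr hlam_neg
  simp only [hρ]
  exact ⟨hU_top, hU_bot, ⟨L, hL⟩, ⟨-L, hL_bot⟩, tendsto_exp_mul_sech_arsinh hL hU_top,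
    tendsto_exp_mul_sech_arsinh hL_bot hU_bot⟩
end

section
/- Fix H > 1 and a ≥ (−H+sqrt(H²−1))/2; set A = 1+2aH, B = sqrt(1+4aH+4a²), α = sqrt(H²−1). Consider the equation B²H²·sin²(2αs) + 2AB·sin(2αs) + A² − α²B² = 0 in the real variable s. (i) If 1+4aH < 0, it has no real solution. (ii) If a = −1/(4H), its solution set is exactly {s : sin(2αs) = −1/H}. (iii) If a > −1/(4H), its solution set is exactly {s : sin(2αs) = (−A+(H²−1)·sqrt(1+4aH))/(BH²)} ∪ {s : sin(2αs) = (−A−(H²−1)·sqrt(1+4aH))/(BH²)}. -/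
/-- Completing the square in the vertical tangency equation. -/
theorem tangency_eq_zero_iff {H a A B α : ℝ} (hH : 1 < H) (hA : A = 1 + 2*a*H)
    (hB : B ^ 2 = 1 + 4*a*H + 4*a ^ 2) (hα : α ^ 2 = H ^ 2 - 1) (x : ℝ) :
    B ^ 2 * H ^ 2 * x ^ 2 + 2 * A * B * x + A ^ 2 - α ^ 2 * B ^ 2 = 0 ↔
      (B * H ^ 2 * x + A) ^ 2 = (H ^ 2 - 1) ^ 2 * (1 + 4*a*H) := by
  have hH2 : H ^ 2 ≠ 0 := by positivity
  have key : H ^ 2 * (B ^ 2 * H ^ 2 * x ^ 2 + 2 * A * B * x + A ^ 2 - α ^ 2 * B ^ 2)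
      = (B * H ^ 2 * x + A) ^ 2 - (H ^ 2 - 1) ^ 2 * (1 + 4*a*H) := by
    rw [hα]
    subst hA
    linear_combination (-(H ^ 2 * (H ^ 2 - 1))) * hB
  rw [← sub_eq_zero (a := (B * H ^ 2 * x + A) ^ 2), ← key, mul_eq_zero, or_iff_right hH2]

/-- For `H > 1`, `a ≥ (−H+√(H²−1))/2`, `A = 1+2aH`, `B = √(1+4aH+4a²)`, `α = √(H²−1)`, the
vertical tangency equation `B²H² sin²(2αs) + 2AB sin(2αs) + A² − α²B² = 0`:
(i) has no real solution when `1+4aH < 0`;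
(ii) has solution set `{s : sin(2αs) = −1/H}` when `a = −1/(4H)`;
(iii) has solution set `{s : sin(2αs) = (−A+(H²−1)√(1+4aH))/(BH²)} ∪
{s : sin(2αs) = (−A−(H²−1)√(1+4aH))/(BH²)}` when `a > −1/(4H)`. -/
theorem tangency_solutions_H_gt_one (H a A B α : ℝ)
    (hH : 1 < H) (ha : (-H + Real.sqrt (H ^ 2 - 1)) / 2 ≤ a)
    (hA : A = 1 + 2*a*H) (hB : B = Real.sqrt (1 + 4*a*H + 4*a ^ 2))
    (hα : α = Real.sqrt (H ^ 2 - 1)) :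
    (1 + 4*a*H < 0 →
      ¬ ∃ s : ℝ, B ^ 2 * H ^ 2 * Real.sin (2*α*s) ^ 2 + 2 * A * B * Real.sin (2*α*s)
          + A ^ 2 - α ^ 2 * B ^ 2 = 0) ∧
    (a = -1/(4*H) →
      {s : ℝ | B ^ 2 * H ^ 2 * Real.sin (2*α*s) ^ 2 + 2 * A * B * Real.sin (2*α*s)
          + A ^ 2 - α ^ 2 * B ^ 2 = 0}
        = {s : ℝ | Real.sin (2*α*s) = -1/H}) ∧
    (-1/(4*H) < a →
      {s : ℝ | B ^ 2 * H ^ 2 * Real.sin (2*α*s) ^ 2 + 2 * A * B * Real.sin (2*α*s)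
          + A ^ 2 - α ^ 2 * B ^ 2 = 0}
        = {s : ℝ | Real.sin (2*α*s)
              = (-A + (H ^ 2 - 1) * Real.sqrt (1 + 4*a*H)) / (B * H ^ 2)}
          ∪ {s : ℝ | Real.sin (2*α*s)
              = (-A - (H ^ 2 - 1) * Real.sqrt (1 + 4*a*H)) / (B * H ^ 2)}) := by
  have hα2 : α ^ 2 = H ^ 2 - 1 := by rw [hα, Real.sq_sqrt (by nlinarith)]
  have hB2 : B ^ 2 = 1 + 4*a*H + 4*a ^ 2 := by
    rw [hB, Real.sq_sqrt]
    have hα0 : 0 ≤ α := hα ▸ Real.sqrt_nonneg _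
    rw [← hα] at ha
    nlinarith
  have hH0 : 0 < H := by linarith
  simp only [tangency_eq_zero_iff hH hA hB2 hα2]
  refine ⟨?_, ?_, ?_⟩
  · rintro h ⟨s, hs⟩
    have hpos : 0 < (H ^ 2 - 1) ^ 2 := by
      have : 0 < H ^ 2 - 1 := by nlinarith
      positivity
    nlinarith [sq_nonneg (B * H ^ 2 * Real.sin (2*α*s) + A)]
  · intro h
    have h0 : 1 + 4*a*H = 0 := by rw [h]; field_simp; ring
    have hBH : B = 1 / (2*H) := by
      rw [hB, h0, zero_add, h, ← Real.sqrt_sq (by positivity : 0 ≤ 1 / (2*H))]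
      congr 1
      field_simp
      norm_num
    have hA' : A = 1 / 2 := by linarith
    ext s
    simp only [Set.mem_ofPred_eq, h0, mul_zero, pow_eq_zero_iff two_ne_zero]
    rw [hBH, hA', eq_div_iff hH0.ne']
    have : 1 / (2*H) * H ^ 2 = H / 2 := by field_simp
    rw [this]
    constructor <;> intro h <;> linarith
  · intro h
    have h0 : 0 < 1 + 4*a*H := by
      rw [div_lt_iff₀ (by positivity)] at h
      linarith
    have hB0 : 0 < B := by
      rw [hB]
      positivity
    have hsq : (H ^ 2 - 1) ^ 2 * (1 + 4*a*H) = ((H ^ 2 - 1) * Real.sqrt (1 + 4*a*H)) ^ 2 := by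
      rw [mul_pow, Real.sq_sqrt h0.le]
    ext s
    simp only [Set.mem_ofPred_eq, Set.mem_union]
    rw [hsq, sq_eq_sq_iff_eq_or_eq_neg, eq_div_iff (by positivity), eq_div_iff (by positivity)]
    constructor <;> rintro (h | h)
    · left; linarith
    · right; linarith
    · left; linarith
    · right; linarith
end

section
/- Fix H > 1 and a ≥ (−H+sqrt(H²−1))/2, and define U, ρ, λ and the profile curve c(s) = e^{λ(s)}·(tanh ρ(s), sech ρ(s)) as in the H > 1 natural parametrization, with α = sqrt(H²−1). Then for all s: ρ(s+π/α) = ρ(s), λ(s+π/α) = λ(s) + λ(π/α), and consequently c(s+π/α) = e^{λ(π/α)}·c(s); that is, the profile curve is invariant under the hyperbolic translation (Euclidean homothety centered at the origin) with factor e^{λ(π/α)}, so it is periodic with period π/α. -/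
open MeasureTheory in
/-- The primitive based at `0` of a locally integrable periodic function is additive over a
period. -/
theorem Function.Periodic.intervalIntegral_zero_add_period {f : ℝ → ℝ} {T : ℝ}
    (hf : Function.Periodic f T) (hint : ∀ x y, IntervalIntegrable f volume x y) (s : ℝ) :
    ∫ t in (0 : ℝ)..(s + T), f t = (∫ t in (0 : ℝ)..s, f t) + ∫ t in (0 : ℝ)..T, f t := by
  rw [← intervalIntegral.integral_add_adjacent_intervals (hint 0 s) (hint s (s + T)),
    hf.intervalIntegral_add_eq s 0, zero_add]

/-- The derivative of the height function `λ` is continuous, even for `a = 0`, where its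
denominator vanishes together with its numerator. -/
theorem continuous_profile_height_deriv (H a A B α : ℝ)
    (hH : 1 < H) (ha : (-H + Real.sqrt (H ^ 2 - 1)) / 2 ≤ a)
    (hA : A = 1 + 2*a*H) (hB : B = Real.sqrt (1 + 4*a*H + 4*a ^ 2))
    (hα : α = Real.sqrt (H ^ 2 - 1)) :
    Continuous fun t : ℝ =>
      (Real.sqrt 2 * α * (2*a + H * (1 + B * Real.sin (2*α*t)))
          * Real.sqrt (A + B * Real.sin (2*α*t)))
        / ((2*a + H * (1 + B * Real.sin (2*α*t))) ^ 2
            + α ^ 2 * B ^ 2 * Real.cos (2*α*t) ^ 2) := by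
  have hα_pos : 0 < α := hα ▸ Real.sqrt_pos.2 (by nlinarith)
  have hα_sq : α ^ 2 = H ^ 2 - 1 := by rw [hα, Real.sq_sqrt (by nlinarith)]
  rw [← hα] at ha
  rcases eq_or_ne a 0 with rfl | ha_ne
  · obtain rfl : B = 1 := by simp [hB]
    obtain rfl : A = 1 := by simp [hA]
    have hden (t : ℝ) : 0 < H ^ 2 + α ^ 2 + Real.sin (2*α*t) := by
      nlinarith [Real.neg_one_le_sin (2*α*t)]
    have heq : (fun t : ℝ =>
        (Real.sqrt 2 * α * (2*0 + H * (1 + 1 * Real.sin (2*α*t)))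
            * Real.sqrt (1 + 1 * Real.sin (2*α*t)))
          / ((2*0 + H * (1 + 1 * Real.sin (2*α*t))) ^ 2
              + α ^ 2 * 1 ^ 2 * Real.cos (2*α*t) ^ 2)) =
        fun t => Real.sqrt 2 * α * H * Real.sqrt (1 + Real.sin (2*α*t))
          / (H ^ 2 + α ^ 2 + Real.sin (2*α*t)) := by
      funext t
      have hfactor : (2*0 + H * (1 + 1 * Real.sin (2*α*t))) ^ 2
          + α ^ 2 * 1 ^ 2 * Real.cos (2*α*t) ^ 2
          = (1 + Real.sin (2*α*t)) * (H ^ 2 + α ^ 2 + Real.sin (2*α*t)) := by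
        rw [Real.cos_sq', hα_sq]
        ring
      rw [hfactor]
      rcases eq_or_ne (1 + Real.sin (2*α*t)) 0 with h | h
      · simp [h]
      · rw [one_mul, div_eq_div_iff (mul_ne_zero h (hden t).ne') (hden t).ne']
        ring
    rw [heq]
    exact Continuous.div (by fun_prop) (by fun_prop) fun t => (hden t).ne'
  · have hB_sq : B ^ 2 = (2*a + H) ^ 2 - α ^ 2 := by
      rw [hB, Real.sq_sqrt (by nlinarith), hα_sq]
      ring
    refine Continuous.div (by fun_prop) (by fun_prop) fun t h => ha_ne ?_
    have hfst : 2*a + H * (1 + B * Real.sin (2*α*t)) = 0 := by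
      have : 0 ≤ α ^ 2 * B ^ 2 * Real.cos (2*α*t) ^ 2 := by positivity
      nlinarith [sq_nonneg (2*a + H * (1 + B * Real.sin (2*α*t)))]
    have hsnd : B ^ 2 * (1 - Real.sin (2*α*t) ^ 2) = 0 := by
      rw [hfst, Real.cos_sq'] at h
      refine (mul_eq_zero.1 (?_ : α ^ 2 * _ = 0)).resolve_left (by positivity)
      linear_combination h
    have hsq : (2*a + H) ^ 2 = H ^ 2 := by
      refine mul_left_cancel₀ (pow_ne_zero 2 hα_pos.ne') ?_
      linear_combination (2*a + H) ^ 2 * hα_sq - H ^ 2 * hB_sq + H ^ 2 * hsnd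
        - (2*a + H - H * B * Real.sin (2*α*t)) * hfst
    have := (sq_eq_sq₀ (by linarith) (by linarith)).1 hsq
    linarith

/-- Periodicity of the `H > 1` profile curve: `ρ(s+π/α) = ρ(s)`,
`λ(s+π/α) = λ(s) + λ(π/α)`, and consequently `c(s+π/α) = e^{λ(π/α)}·c(s)`: the profile
curve is invariant under the hyperbolic translation (Euclidean homothety centered at the
origin) with factor `e^{λ(π/α)}`, so it is periodic with period `π/α`. -/
theorem profile_curve_periodicity_H_gt_one (H a A B α : ℝ)
    (hH : 1 < H) (ha : (-H + Real.sqrt (H ^ 2 - 1)) / 2 ≤ a)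
    (hA : A = 1 + 2*a*H) (hB : B = Real.sqrt (1 + 4*a*H + 4*a ^ 2))
    (hα : α = Real.sqrt (H ^ 2 - 1))
    (U ρ lam : ℝ → ℝ) (c : ℝ → ℝ × ℝ)
    (hU : ∀ s, U s = Real.sqrt ((A + B * Real.sin (2*α*s)) / (2 * α ^ 2)))
    (hρ : ∀ s, ρ s = Real.arsinh (U s))
    (hlam : ∀ s, lam s = ∫ t in (0:ℝ)..s,
      (Real.sqrt 2 * α * (2*a + H * (1 + B * Real.sin (2*α*t)))
          * Real.sqrt (A + B * Real.sin (2*α*t)))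
        / ((2*a + H * (1 + B * Real.sin (2*α*t))) ^ 2
            + α ^ 2 * B ^ 2 * Real.cos (2*α*t) ^ 2))
    (hc : ∀ s, c s = (Real.exp (lam s) * Real.tanh (ρ s),
                      Real.exp (lam s) * (1 / Real.cosh (ρ s)))) :
    (∀ s, ρ (s + Real.pi / α) = ρ s) ∧
    (∀ s, lam (s + Real.pi / α) = lam s + lam (Real.pi / α)) ∧
    (∀ s, c (s + Real.pi / α) = Real.exp (lam (Real.pi / α)) • c s) := by
  have hα_pos : 0 < α := hα ▸ Real.sqrt_pos.2 (by nlinarith)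
  have harg (s : ℝ) : 2*α*(s + Real.pi / α) = 2*α*s + 2 * Real.pi := by
    field_simp
  have hρ_per (s : ℝ) : ρ (s + Real.pi / α) = ρ s := by
    rw [hρ, hρ, hU, hU, harg, Real.sin_add_two_pi]
  have hlam_per (s : ℝ) : lam (s + Real.pi / α) = lam s + lam (Real.pi / α) := by
    rw [hlam, hlam, hlam]
    refine Function.Periodic.intervalIntegral_zero_add_period (fun t => ?_)
      (continuous_profile_height_deriv H a A B α hH ha hA hB hα).intervalIntegrable s
    simp only [harg, Real.sin_add_two_pi, Real.cos_add_two_pi]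
  refine ⟨hρ_per, hlam_per, fun s => ?_⟩
  rw [hc, hc, hρ_per, hlam_per, Real.exp_add]
  ext <;> simp only [Prod.smul_mk, smul_eq_mul] <;> ring
end
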